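/- Assume z* ∈ ℝⁿ and s ∈ ℝⁿ satisfy Dᵀ(Dz* − y) + λs = 0. Let z ∈ ℝⁿ, let S ⊆ {1,…,n} contain supp(z) ∪ supp(z*), and let J = (J_l)_{l=1}^m be any family of n×n real matrices. Define g² ∈ ℝ^{m×n} with l-th row (Dz − y)_l zᵀ + ((J_l)ᵀ(Dᵀ(Dz − y) + λs))ᵀ, and g* = (Dz* − y)(z*)ᵀ. Then the exact decomposition g² − g* = R(J, S)(z − z*) + E holds, where E ∈ ℝ^{m×n} is the matrix with l-th row (D(z − z*))_l (z − z*)ᵀ; in particular ‖E‖_F ≤ ‖D‖ ‖z − z*‖². -/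

import Mathlib

open scoped BigOperators
open Matrix

noncomputable def eunorm {α : Type*} [Fintype α] (v : α → ℝ) : ℝ :=
  Real.sqrt (∑ i, v i ^ 2)

noncomputable def frobnorm {α β : Type*} [Fintype α] [Fintype β] (A : Matrix α β ℝ) : ℝ :=
  Real.sqrt (∑ i, ∑ j, A i j ^ 2)

noncomputable def l2opnorm {α β : Type*} [Fintype α] [Fintype β] (A : Matrix α β ℝ) : ℝ :=
  sInf {c : ℝ | 0 ≤ c ∧ ∀ v : β → ℝ, eunorm (A.mulVec v) ≤ c * eunorm v}

open scoped Classical in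
noncomputable def supp {n : ℕ} (z : Fin n → ℝ) : Finset (Fin n) :=
  Finset.univ.filter fun i => z i ≠ 0

noncomputable def rowMask {n : ℕ} (S : Finset (Fin n)) (M : Matrix (Fin n) (Fin n) ℝ) :
    Matrix (Fin n) (Fin n) ℝ :=
  Matrix.of fun i j => if i ∈ S then M i j else 0

def restrVec {n : ℕ} (S : Finset (Fin n)) (h : Fin n → ℝ) : Fin n → ℝ :=
  fun i => if i ∈ S then h i else 0

def colSub {m n : ℕ} (D : Matrix (Fin m) (Fin n) ℝ) (S : Finset (Fin n)) :
    Matrix (Fin m) {i // i ∈ S} ℝ :=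
  D.submatrix id Subtype.val

noncomputable def gram {m n : ℕ} (D : Matrix (Fin m) (Fin n) ℝ) (S : Finset (Fin n)) :
    Matrix {i // i ∈ S} {i // i ∈ S} ℝ :=
  (colSub D S)ᵀ * colSub D S

noncomputable def Nmat {m n : ℕ} (D : Matrix (Fin m) (Fin n) ℝ) (y : Fin m → ℝ)
    (l : Fin m) (z : Fin n → ℝ) : Matrix (Fin n) (Fin n) ℝ :=
  Matrix.vecMulVec (D l) z + (dotProduct (D l) z - y l) • (1 : Matrix (Fin n) (Fin n) ℝ)

noncomputable def umat {m n : ℕ} (D : Matrix (Fin m) (Fin n) ℝ) (y : Fin m → ℝ)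
    (l : Fin m) (L : ℝ) (z : Fin n → ℝ) : Matrix (Fin n) (Fin n) ℝ :=
  (-(1 / L)) • Nmat D y l z

noncomputable def Gmat {m n : ℕ} (D : Matrix (Fin m) (Fin n) ℝ) (L : ℝ) :
    Matrix (Fin n) (Fin n) ℝ :=
  1 - (1 / L) • (Dᵀ * D)

noncomputable def Jstar {m n : ℕ} (D : Matrix (Fin m) (Fin n) ℝ) (y : Fin m → ℝ)
    (l : Fin m) (z : Fin n → ℝ) (S : Finset (Fin n)) : Matrix (Fin n) (Fin n) ℝ :=
  Matrix.of fun i j =>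
    if h : i ∈ S then
      (-((gram D S)⁻¹ * (Nmat D y l z).submatrix (Subtype.val : {i // i ∈ S} → Fin n) id))
        ⟨i, h⟩ j
    else 0

noncomputable def Rmap {m n : ℕ} (D : Matrix (Fin m) (Fin n) ℝ) (y : Fin m → ℝ)
    (zstar : Fin n → ℝ) (J : Fin m → Matrix (Fin n) (Fin n) ℝ) (S : Finset (Fin n))
    (h : Fin n → ℝ) : Matrix (Fin m) (Fin n) ℝ :=
  Matrix.of fun l j =>
    ((J l)ᵀ.mulVec ((Dᵀ * D).mulVec (restrVec S h))) j
      + (D.mulVec (restrVec S h)) l * zstar j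
      + (D.mulVec zstar - y) l * restrVec S h j

noncomputable def mapOpNorm {m n : ℕ} (Φ : (Fin n → ℝ) → Matrix (Fin m) (Fin n) ℝ) : ℝ :=
  sInf {c : ℝ | 0 ≤ c ∧ ∀ h : Fin n → ℝ, frobnorm (Φ h) ≤ c * eunorm h}

noncomputable def Mmat {m n : ℕ} (D : Matrix (Fin m) (Fin n) ℝ) (Sstar E : Finset (Fin n))
    (U : Matrix (Fin n) (Fin n) ℝ) : Matrix (Fin n) (Fin n) ℝ :=
  Matrix.of fun i j =>
    if h : i ∈ E then
      U i j -
        ((colSub D E)ᵀ * colSub D Sstar * (gram D Sstar)⁻¹ *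
          U.submatrix (Subtype.val : {i // i ∈ Sstar} → Fin n) id) ⟨i, h⟩ j
    else 0

noncomputable def Cmat {m n : ℕ} (D : Matrix (Fin m) (Fin n) ℝ) (Sstar E : Finset (Fin n)) :
    Matrix (Fin n) (Fin n) ℝ :=
  Matrix.of fun i j =>
    if h : i ∈ E then
      if h' : j ∈ Sstar then
        ((colSub D E)ᵀ * colSub D Sstar * (gram D Sstar)⁻¹) ⟨i, h⟩ ⟨j, h'⟩
      else 0
    else 0

noncomputable def Pdiag {n : ℕ} (S : Finset (Fin n)) : Matrix (Fin n) (Fin n) ℝ :=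
  Matrix.diagonal fun i => if i ∈ S then (1 : ℝ) else 0

noncomputable def STv {n : ℕ} (μ : ℝ) (x : Fin n → ℝ) : Fin n → ℝ :=
  fun i => Real.sign (x i) * max (|x i| - μ) 0

theorem eunorm_nonneg {α : Type*} [Fintype α] (v : α → ℝ) : 0 ≤ eunorm v :=
  Real.sqrt_nonneg _

theorem eunorm_mulVec_le_frobnorm {α β : Type*} [Fintype α] [Fintype β]
    (A : Matrix α β ℝ) (v : β → ℝ) : eunorm (A.mulVec v) ≤ frobnorm A * eunorm v := by
  unfold eunorm frobnorm
  rw [← Real.sqrt_mul (by positivity), Finset.sum_mul]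
  exact Real.sqrt_le_sqrt
    (Finset.sum_le_sum fun i _ => Finset.sum_mul_sq_le_sq_mul_sq Finset.univ (A i) v)

theorem eunorm_mulVec_le {α β : Type*} [Fintype α] [Fintype β]
    (A : Matrix α β ℝ) (v : β → ℝ) : eunorm (A.mulVec v) ≤ l2opnorm A * eunorm v := by
  have hfrob : frobnorm A ∈
      {c : ℝ | 0 ≤ c ∧ ∀ v : β → ℝ, eunorm (A.mulVec v) ≤ c * eunorm v} :=
    ⟨Real.sqrt_nonneg _, eunorm_mulVec_le_frobnorm A⟩
  rcases (eunorm_nonneg v).eq_or_lt with hv | hv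
  · simpa [← hv] using eunorm_mulVec_le_frobnorm A v
  · rw [← div_le_iff₀ hv]
    exact le_csInf ⟨_, hfrob⟩ fun c hc => (div_le_iff₀ hv).2 (hc.2 v)

theorem frobnorm_vecMulVec {α β : Type*} [Fintype α] [Fintype β] (u : α → ℝ) (v : β → ℝ) :
    frobnorm (vecMulVec u v) = eunorm u * eunorm v := by
  unfold frobnorm eunorm
  rw [← Real.sqrt_mul (by positivity), Finset.sum_mul_sum]
  simp only [vecMulVec_apply, mul_pow]

theorem restrVec_sub_of_supp_union_subset {n : ℕ} {z w : Fin n → ℝ} {S : Finset (Fin n)}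
    (hS : supp z ∪ supp w ⊆ S) : restrVec S (z - w) = z - w := by
  funext i
  by_cases hi : i ∈ S
  · simp [restrVec, hi]
  · have hzw := mt (@hS i) hi
    simp only [supp, Finset.mem_union, Finset.mem_filter, Finset.mem_univ, true_and,
      not_or, not_not] at hzw
    simp [restrVec, hi, hzw.1, hzw.2]

/-- exact decomposition of the difference between the
automatic-differentiation gradient estimate and the exact gradient. -/
theorem autodiff_gradient_exact_decomposition
    {m n : ℕ} (D : Matrix (Fin m) (Fin n) ℝ) (y : Fin m → ℝ)
    (lam : ℝ) (hlam : 0 < lam)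
    (zstar s : Fin n → ℝ)
    (hopt : Dᵀ.mulVec (D.mulVec zstar - y) + lam • s = 0)
    (z : Fin n → ℝ) (S : Finset (Fin n))
    (hS : supp z ∪ supp zstar ⊆ S)
    (J : Fin m → Matrix (Fin n) (Fin n) ℝ)
    (g2 gstar E : Matrix (Fin m) (Fin n) ℝ)
    (hg2 : g2 = Matrix.of fun l j => (D.mulVec z - y) l * z j
      + ((J l)ᵀ.mulVec (Dᵀ.mulVec (D.mulVec z - y) + lam • s)) j)
    (hgstar : gstar = Matrix.vecMulVec (D.mulVec zstar - y) zstar)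
    (hE : E = Matrix.of fun l j => (D.mulVec (z - zstar)) l * (z - zstar) j) :
    g2 - gstar = Rmap D y zstar J S (z - zstar) + E
      ∧ frobnorm E ≤ l2opnorm D * eunorm (z - zstar) ^ 2 := by
  have hgrad : Dᵀ.mulVec (D.mulVec z - y) + lam • s = (Dᵀ * D).mulVec (z - zstar) := by
    rw [← sub_zero (Dᵀ.mulVec (D.mulVec z - y) + lam • s), ← hopt, ← mulVec_mulVec]
    simp only [mulVec_sub]
    abel
  constructor
  · ext l j
    simp only [hg2, hgstar, hE, hgrad, Rmap, restrVec_sub_of_supp_union_subset hS,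
      Matrix.sub_apply, Matrix.add_apply, of_apply, vecMulVec_apply, mulVec_sub D z zstar,
      Pi.sub_apply]
    ring
  · have hE' : E = vecMulVec (D.mulVec (z - zstar)) (z - zstar) := hE
    rw [hE', frobnorm_vecMulVec, pow_two, ← mul_assoc]
    exact mul_le_mul_of_nonneg_right (eunorm_mulVec_le D _) (eunorm_nonneg _)
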